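/- arXiv:1912.11814 — 7 statements merged into one kernel-verified Lean document; each statement's English description precedes it below -/
import Mathlib

section
/- Let X be a subset of V with 2 ≤ |X| and X ≠ V. Then H(V) − H(X) + R_ACO(X) ≤ R_ACO(V) holds if and only if f_{R_ACO(V)}(X) = f̂_{R_ACO(V)}(X), i.e., the residual entropy function evaluated at X at parameter α = R_ACO(V) equals its Dilworth truncation at X. -/
open Finset

variable {ι : Type*} [DecidableEq ι]

/-- `P` is a partition of the finite set `X`: its blocks are nonempty,
pairwise disjoint, and their union is `X`. -/
def IsPartition (X : Finset ι) (P : Finset (Finset ι)) : Prop :=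
  (∀ C ∈ P, C.Nonempty) ∧
  (∀ C ∈ P, ∀ D ∈ P, C ≠ D → Disjoint C D) ∧
  P.sup id = X

/-- The residual entropy function `f_α(X) = α - H(V) + H(X)`. -/
noncomputable def fRes (H : Finset ι → ℝ) (V : Finset ι) (α : ℝ) (X : Finset ι) : ℝ :=
  α - H V + H X

/-- The Dilworth truncation `f̂_α(X) = min_{P ∈ Π(X)} Σ_{C ∈ P} f_α(C)`. -/
noncomputable def dilworth (H : Finset ι → ℝ) (V : Finset ι) (α : ℝ) (X : Finset ι) : ℝ :=
  sInf { s : ℝ | ∃ P : Finset (Finset ι), IsPartition X P ∧ s = ∑ C ∈ P, fRes H V α C }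

/-- The minimum sum-rate for the asymptotic model:
`R_ACO(X) = max_{P ∈ Π(X), |P| ≥ 2} Σ_{C ∈ P} (H(X) - H(C))/(|P| - 1)`. -/
noncomputable def RACO (H : Finset ι → ℝ) (X : Finset ι) : ℝ :=
  sSup { s : ℝ | ∃ P : Finset (Finset ι), IsPartition X P ∧ 2 ≤ P.card ∧
    s = ∑ C ∈ P, (H X - H C) / ((P.card : ℝ) - 1) }

/-- The minimum sum-rate for the non-asymptotic model: `R_NCO(X) = ⌈R_ACO(X)⌉`. -/
noncomputable def RNCO (H : Finset ι → ℝ) (X : Finset ι) : ℝ :=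
  (⌈RACO H X⌉ : ℝ)

theorem isPartition_finite (X : Finset ι) : {P : Finset (Finset ι) | IsPartition X P}.Finite := by
  apply (X.powerset.powerset).finite_toSet.subset
  intro P hP
  simp only [Finset.coe_powerset, Set.mem_preimage, Set.mem_powerset_iff, Finset.mem_coe, Finset.mem_powerset]
  intro C hC
  have h : C ⊆ P.sup id := Finset.le_sup (f := id) hC
  rw [hP.2.2] at h
  simpa using h

theorem isPartition_single (X : Finset ι) (hX : X.Nonempty) : IsPartition X {X} := by
  refine ⟨by simpa using hX, ?_, by simp⟩
  intro C hC D hD hne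
  simp only [Finset.mem_singleton] at hC hD
  exact absurd (hC.trans hD.symm) hne

theorem exists_isPartition_two (X : Finset ι) (hX : 2 ≤ X.card) :
    ∃ P, IsPartition X P ∧ 2 ≤ P.card := by
  refine ⟨X.image (fun x => {x}), ⟨?_, ?_, ?_⟩, ?_⟩
  · simp
  · intro C hC D hD hne
    simp only [Finset.mem_image] at hC hD
    obtain ⟨x, _, rfl⟩ := hC
    obtain ⟨y, _, rfl⟩ := hD
    simp only [Finset.disjoint_singleton]
    rintro rfl
    exact hne rfl
  · ext a
    simp [Finset.mem_sup]
  · rw [Finset.card_image_of_injective _ Finset.singleton_injective]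
    exact hX

theorem part_key (H : Finset ι → ℝ) (V X : Finset ι) (α : ℝ) (P : Finset (Finset ι))
    (h2 : 2 ≤ P.card) :
    ∑ C ∈ P, (H X - H C) / ((P.card : ℝ) - 1) ≤ α - H V + H X ↔
      fRes H V α X ≤ ∑ C ∈ P, fRes H V α C := by
  have h2' : (2 : ℝ) ≤ P.card := by exact_mod_cast h2
  rw [← Finset.sum_div, div_le_iff₀ (by linarith)]
  simp only [fRes, Finset.sum_add_distrib, Finset.sum_sub_distrib, Finset.sum_const, nsmul_eq_mul]
  constructor <;> intro h <;> linarith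

theorem complimentary_iff_dilworth_asymptotic
    (V : Finset ι) (hV : 2 ≤ V.card) (H : Finset ι → ℝ)
    (X : Finset ι) (hXV : X ⊆ V) (hX2 : 2 ≤ X.card) (hXne : X ≠ V) :
    H V - H X + RACO H X ≤ RACO H V ↔
      fRes H V (RACO H V) X = dilworth H V (RACO H V) X := by
  generalize RACO H V = α
  have hne : X.Nonempty := Finset.card_pos.mp (by omega)
  have hmem : fRes H V α X ∈ { s : ℝ | ∃ P : Finset (Finset ι), IsPartition X P ∧
      s = ∑ C ∈ P, fRes H V α C } := ⟨{X}, isPartition_single X hne, by simp⟩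
  have hbdd : BddBelow { s : ℝ | ∃ P : Finset (Finset ι), IsPartition X P ∧
      s = ∑ C ∈ P, fRes H V α C } := by
    apply Set.Finite.bddBelow
    apply ((isPartition_finite X).image (fun P => ∑ C ∈ P, fRes H V α C)).subset
    rintro s ⟨P, hP, rfl⟩
    exact ⟨P, hP, rfl⟩
  have hbdd2 : BddAbove { s : ℝ | ∃ P : Finset (Finset ι), IsPartition X P ∧ 2 ≤ P.card ∧
      s = ∑ C ∈ P, (H X - H C) / ((P.card : ℝ) - 1) } := by
    apply Set.Finite.bddAbove
    apply ((isPartition_finite X).image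
      (fun P => ∑ C ∈ P, (H X - H C) / ((P.card : ℝ) - 1))).subset
    rintro s ⟨P, hP, _, rfl⟩
    exact ⟨P, hP, rfl⟩
  constructor
  · intro h
    apply le_antisymm
    · apply le_csInf ⟨_, hmem⟩
      rintro s ⟨P, hP, rfl⟩
      rcases Nat.lt_or_ge P.card 2 with h2 | h2
      · have h01 : P.card = 0 ∨ P.card = 1 := by omega
        rcases h01 with h0 | h1
        · rw [Finset.card_eq_zero] at h0
          have hs := hP.2.2
          rw [h0] at hs
          simp only [Finset.sup_empty, Finset.bot_eq_empty] at hs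
          exact absurd hs.symm hne.ne_empty
        · obtain ⟨Y, rfl⟩ := Finset.card_eq_one.mp h1
          have hs := hP.2.2
          simp only [Finset.sup_singleton, id] at hs
          simp [hs]
      · rw [← part_key H V X α P h2]
        have : _ ≤ RACO H X := le_csSup hbdd2 ⟨P, hP, h2, rfl⟩
        linarith
    · exact csInf_le hbdd hmem
  · intro h
    have : RACO H X ≤ α - H V + H X := by
      obtain ⟨P, hP, h2⟩ := exists_isPartition_two X hX2
      unfold RACO
      refine csSup_le ⟨_, P, hP, h2, rfl⟩ ?_
      rintro s ⟨Q, hQ, hQ2, rfl⟩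
      rw [part_key H V X α Q hQ2, h]
      exact csInf_le hbdd ⟨Q, hQ, rfl⟩
    linarith
end

section
/- Let X ⊆ V with 2 ≤ |X| and X ≠ V, and let α_low ∈ ℝ with α_low ≤ R_ACO(V). If f_{α_low}(X) = f̂_{α_low}(X), then X is complimentary for the asymptotic model, i.e., H(V) − H(X) + R_ACO(X) ≤ R_ACO(V). -/
open Finset

variable {ι : Type*} [DecidableEq ι]

theorem sufficient_condition_asymptotic
    (V : Finset ι) (hV : 2 ≤ V.card) (H : Finset ι → ℝ)
    (X : Finset ι) (hXV : X ⊆ V) (hX2 : 2 ≤ X.card) (hXne : X ≠ V)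
    (αlow : ℝ) (hαlow : αlow ≤ RACO H V)
    (h : fRes H V αlow X = dilworth H V αlow X) :
    H V - H X + RACO H X ≤ RACO H V := by
  have hfin : { s : ℝ | ∃ P : Finset (Finset ι), IsPartition X P ∧
      s = ∑ C ∈ P, fRes H V αlow C }.Finite := by
    refine ((X.powerset.powerset.finite_toSet).image
      (fun P => ∑ C ∈ P, fRes H V αlow C)).subset ?_
    rintro s ⟨P, hP, rfl⟩
    refine ⟨P, ?_, rfl⟩
    simp only [Finset.coe_powerset, Set.mem_preimage, Set.mem_powerset_iff]
    intro C hC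
    have h1 : C ≤ P.sup id := Finset.le_sup (f := id) hC
    rw [hP.2.2] at h1
    simpa using h1
  have key : RACO H X ≤ H X - H V + αlow := by
    unfold RACO
    apply csSup_le
    · refine ⟨_, X.image (fun x => {x}), ⟨?_, ?_, ?_⟩, ?_, rfl⟩
      · intro C hC
        obtain ⟨x, _, rfl⟩ := Finset.mem_image.1 hC
        exact Finset.singleton_nonempty x
      · intro C hC D hD hne
        obtain ⟨x, _, rfl⟩ := Finset.mem_image.1 hC
        obtain ⟨y, _, rfl⟩ := Finset.mem_image.1 hD
        rw [Finset.disjoint_singleton]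
        rintro rfl
        exact hne rfl
      · ext a
        simp [Finset.mem_sup]
      · rw [Finset.card_image_of_injective _ Finset.singleton_injective]
        exact hX2
    · rintro s ⟨P, hP, hc, rfl⟩
      have h1 : fRes H V αlow X ≤ ∑ C ∈ P, fRes H V αlow C := by
        rw [h]
        exact csInf_le hfin.bddBelow ⟨P, hP, rfl⟩
      have hc' : (2 : ℝ) ≤ (P.card : ℝ) := by exact_mod_cast hc
      rw [← Finset.sum_div, div_le_iff₀ (by linarith)]
      simp only [fRes, Finset.sum_add_distrib, Finset.sum_sub_distrib,
        Finset.sum_const, nsmul_eq_mul] at h1 ⊢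
      nlinarith
  linarith
end

section
/- Suppose H takes integer values on all subsets of V. Let X ⊆ V with 2 ≤ |X| and X ≠ V, and let α_low be an integer with α_low ≤ R_NCO(V). If f_{α_low}(X) = f̂_{α_low}(X), then X is complimentary for the non-asymptotic model, i.e., H(V) − H(X) + R_NCO(X) ≤ R_NCO(V). -/
open Finset

variable {ι : Type*} [DecidableEq ι]

theorem sufficient_condition_nonasymptotic
    (V : Finset ι) (hV : 2 ≤ V.card) (H : Finset ι → ℝ)
    (hHint : ∀ X ⊆ V, ∃ z : ℤ, H X = z)
    (X : Finset ι) (hXV : X ⊆ V) (hX2 : 2 ≤ X.card) (hXne : X ≠ V)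
    (αlow : ℤ) (hαlow : (αlow : ℝ) ≤ RNCO H V)
    (h : fRes H V (αlow : ℝ) X = dilworth H V (αlow : ℝ) X) :
    H V - H X + RNCO H X ≤ RNCO H V := by
  have hsub : ∀ P : Finset (Finset ι), IsPartition X P → P ⊆ X.powerset := by
    intro P hP C hC
    rw [Finset.mem_powerset, ← hP.2.2]
    exact Finset.le_sup (f := id) hC
  have hbdd : BddBelow { s : ℝ | ∃ P : Finset (Finset ι), IsPartition X P ∧
      s = ∑ C ∈ P, fRes H V (αlow : ℝ) C } := by
    apply Set.Finite.bddBelow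
    apply Set.Finite.subset
      (X.powerset.powerset.image (fun P => ∑ C ∈ P, fRes H V (αlow : ℝ) C)).finite_toSet
    rintro s ⟨P, hP, rfl⟩
    simp only [Finset.coe_image, Set.mem_image, Finset.mem_coe]
    exact ⟨P, Finset.mem_powerset.2 (hsub P hP), rfl⟩
  have key : RACO H X ≤ (αlow : ℝ) - H V + H X := by
    apply csSup_le
    · refine ⟨_, X.image (fun x => {x}), ⟨?_, ?_, ?_⟩, ?_, rfl⟩
      · intro C hC
        obtain ⟨x, _, rfl⟩ := Finset.mem_image.1 hC
        exact Finset.singleton_nonempty x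
      · intro C hC D hD hne
        obtain ⟨x, _, rfl⟩ := Finset.mem_image.1 hC
        obtain ⟨y, _, rfl⟩ := Finset.mem_image.1 hD
        rw [Finset.disjoint_singleton]
        rintro rfl
        exact hne rfl
      · ext a
        simp [Finset.mem_sup]
      · rwa [Finset.card_image_of_injective _ Finset.singleton_injective]
    · rintro s ⟨P, hP, hc, rfl⟩
      have h1 : fRes H V (αlow : ℝ) X ≤ ∑ C ∈ P, fRes H V (αlow : ℝ) C := by
        rw [h]
        exact csInf_le hbdd ⟨P, hP, rfl⟩
      have hc' : (2 : ℝ) ≤ (P.card : ℝ) := by exact_mod_cast hc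
      rw [← Finset.sum_div, div_le_iff₀ (by linarith)]
      simp only [fRes, Finset.sum_add_distrib, Finset.sum_sub_distrib, Finset.sum_const,
        nsmul_eq_mul] at h1 ⊢
      nlinarith
  obtain ⟨a, ha⟩ := hHint V (Finset.Subset.refl V)
  obtain ⟨b, hb⟩ := hHint X hXV
  have h2 : ⌈RACO H X⌉ ≤ αlow - a + b := by
    rw [Int.ceil_le]
    push_cast
    rw [← ha, ← hb]
    exact key
  have h3 : RNCO H X ≤ (αlow : ℝ) - H V + H X := by
    rw [ha, hb]
    unfold RNCO
    exact_mod_cast h2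
  linarith
end

section
/- Let α, α' ∈ ℝ with α < α'. Then { X ⊆ V : 2 ≤ |X|, X ≠ V, f_α(X) = f̂_α(X) } ⊆ { X ⊆ V : 2 ≤ |X|, X ≠ V, f_{α'}(X) = f̂_{α'}(X) }; that is, every nonsingleton proper subset on which the residual entropy function equals its Dilworth truncation at parameter α also has this property at any larger parameter α'. -/
open Finset

variable {ι : Type*} [DecidableEq ι]

theorem complimentary_candidates_mono
    (V : Finset ι) (hV : 2 ≤ V.card) (H : Finset ι → ℝ)
    (α α' : ℝ) (hαα' : α < α') :
    { X : Finset ι | X ⊆ V ∧ 2 ≤ X.card ∧ X ≠ V ∧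
        fRes H V α X = dilworth H V α X } ⊆
      { X : Finset ι | X ⊆ V ∧ 2 ≤ X.card ∧ X ≠ V ∧
        fRes H V α' X = dilworth H V α' X } := by
  rintro X ⟨h1, h2, h3, h4⟩
  refine ⟨h1, h2, h3, ?_⟩
  have hbdd : BddBelow { s : ℝ | ∃ P : Finset (Finset ι), IsPartition X P ∧
      s = ∑ C ∈ P, fRes H V α C } := by
    apply Set.Finite.bddBelow
    apply ((X.powerset.powerset : Finset (Finset (Finset ι))).finite_toSet.image
      (fun P => ∑ C ∈ P, fRes H V α C)).subset
    rintro s ⟨P, hP, rfl⟩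
    refine ⟨P, ?_, rfl⟩
    simp only [Finset.coe_powerset, Set.mem_preimage, Set.mem_powerset_iff, Finset.coe_subset]
    intro C hC
    have h := Finset.le_sup (f := id) hC
    rw [hP.2.2] at h
    simpa using h
  have hXne : X.Nonempty := Finset.card_pos.mp (by omega)
  symm
  apply IsLeast.csInf_eq
  constructor
  · refine ⟨{X}, ⟨?_, ?_, ?_⟩, ?_⟩
    · intro C hC
      rw [Finset.mem_singleton] at hC
      rw [hC]; exact hXne
    · intro C hC D hD hne
      rw [Finset.mem_singleton] at hC hD
      exact absurd (hC.trans hD.symm) hne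
    · simp
    · simp
  · rintro s ⟨P, hP, rfl⟩
    have hle : fRes H V α X ≤ ∑ C ∈ P, fRes H V α C := by
      rw [h4]
      exact csInf_le hbdd ⟨P, hP, rfl⟩
    have hPne : 1 ≤ P.card := by
      rw [Nat.one_le_iff_ne_zero]
      intro h0
      rw [Finset.card_eq_zero] at h0
      have h := hP.2.2
      rw [h0] at h
      simp at h
      rw [← h] at hXne
      simp at hXne
    have hc : (1 : ℝ) ≤ P.card := by exact_mod_cast hPne
    have e : ∑ C ∈ P, fRes H V α' C = ∑ C ∈ P, fRes H V α C + P.card * (α' - α) := by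
      rw [← nsmul_eq_mul, ← Finset.sum_const, ← Finset.sum_add_distrib]
      apply Finset.sum_congr rfl
      intro C _
      unfold fRes
      ring
    have e2 : fRes H V α' X = fRes H V α X + (α' - α) := by
      unfold fRes
      ring
    rw [e, e2]
    nlinarith
end

section
/- Let α_low = Σ_{i ∈ V} (H(V) − H({i}))/(|V| − 1). If no subset X ⊆ V with 2 ≤ |X| and X ≠ V satisfies f_{α_low}(X) = f̂_{α_low}(X), then R_ACO(V) = α_low, and moreover no subset X ⊆ V with 2 ≤ |X| and X ≠ V satisfies H(V) − H(X) + R_ACO(X) ≤ R_ACO(V) (i.e., there is no complimentary subset in the asymptotic model). -/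
open Finset

variable {ι : Type*} [DecidableEq ι]

theorem part_sub {X : Finset ι} {P : Finset (Finset ι)} (hP : IsPartition X P) :
    ∀ C ∈ P, C ⊆ X := by
  intro C hC
  rw [← hP.2.2]
  exact Finset.le_sup (f := id) hC

theorem part_sum {X : Finset ι} {P : Finset (Finset ι)} (hP : IsPartition X P) (g : ι → ℝ) :
    ∑ C ∈ P, ∑ i ∈ C, g i = ∑ i ∈ X, g i := by
  rw [← hP.2.2, Finset.sup_eq_biUnion, Finset.sum_biUnion]
  · rfl
  · intro C hC D hD hne
    exact hP.2.1 C hC D hD hne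

theorem part_single (X : Finset ι) :
    IsPartition X (X.image (fun i => ({i} : Finset ι))) := by
  refine ⟨?_, ?_, ?_⟩
  · intro C hC
    obtain ⟨i, -, rfl⟩ := Finset.mem_image.1 hC
    exact Finset.singleton_nonempty i
  · intro C hC D hD hne
    obtain ⟨i, -, rfl⟩ := Finset.mem_image.1 hC
    obtain ⟨j, -, rfl⟩ := Finset.mem_image.1 hD
    rw [Finset.disjoint_singleton]
    rintro rfl
    exact hne rfl
  · ext a
    simp

theorem part_finite (X : Finset ι) (Q : Finset (Finset ι) → Prop)
    (F : Finset (Finset ι) → ℝ) :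
    { s : ℝ | ∃ P : Finset (Finset ι), IsPartition X P ∧ Q P ∧ s = F P }.Finite := by
  refine ((X.powerset.powerset : Finset (Finset (Finset ι))).finite_toSet.image F).subset ?_
  rintro s ⟨P, hP, -, rfl⟩
  refine ⟨P, ?_, rfl⟩
  refine Finset.mem_coe.2 (Finset.mem_powerset.2 ?_)
  intro C hC
  exact Finset.mem_powerset.2 (part_sub hP C hC)

theorem part_top {X : Finset ι} {P : Finset (Finset ι)} (hP : IsPartition X P)
    (hX : X ∈ P) : P = {X} := by
  rw [Finset.eq_singleton_iff_unique_mem]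
  refine ⟨hX, fun C hC => ?_⟩
  by_contra hne
  have h1 := hP.2.1 C hC X hX hne
  have h2 := hP.1 C hC
  exact h2.ne_empty (Finset.disjoint_self_iff_empty C |>.1 (h1.mono_right (part_sub hP C hC)))

theorem single_lt (V : Finset ι) (H : Finset ι → ℝ) (a : ℝ)
    (h : ∀ X : Finset ι, X ⊆ V → 2 ≤ X.card → X ≠ V →
      fRes H V a X ≠ dilworth H V a X) (X : Finset ι) :
    X ⊆ V → 2 ≤ X.card → X ≠ V → ∑ i ∈ X, fRes H V a {i} < fRes H V a X := by
  induction X using Finset.strongInduction with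
  | H X ih =>
    intro hXV hc hne
    have hfin := part_finite X (fun _ => True) (fun P => ∑ C ∈ P, fRes H V a C)
    simp only [true_and] at hfin
    have hXne : X.Nonempty := Finset.card_pos.1 (by omega)
    have hmem : fRes H V a X ∈ { s : ℝ | ∃ P : Finset (Finset ι), IsPartition X P ∧
        s = ∑ C ∈ P, fRes H V a C } := by
      refine ⟨{X}, ⟨?_, ?_, ?_⟩, ?_⟩
      · simpa using hXne
      · intro C hC D hD hne
        rw [Finset.mem_singleton] at hC hD
        exact absurd (hC.trans hD.symm) hne
      · simp
      · simp
    have hlt : dilworth H V a X < fRes H V a X :=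
      lt_of_le_of_ne (csInf_le hfin.bddBelow hmem) (h X hXV hc hne).symm
    obtain ⟨s, ⟨P, hP, rfl⟩, hs⟩ := exists_lt_of_csInf_lt ⟨_, hmem⟩ hlt
    have hXP : X ∉ P := by
      intro hX
      rw [part_top hP hX] at hs
      simp at hs
    refine lt_of_le_of_lt ?_ hs
    rw [← part_sum hP]
    refine Finset.sum_le_sum fun C hC => ?_
    have hCX := part_sub hP C hC
    have hCne : C ≠ X := fun e => hXP (e ▸ hC)
    have hss := Finset.ssubset_iff_subset_ne.2 ⟨hCX, hCne⟩
    rcases Nat.lt_or_ge C.card 2 with h1 | h2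
    · have h3 := Finset.card_pos.2 (hP.1 C hC)
      obtain ⟨i, rfl⟩ := Finset.card_eq_one.1 (show C.card = 1 by omega)
      simp
    · exact (ih C hss (hCX.trans hXV) h2 (hss.trans_subset hXV).ne).le

theorem single_mem (H : Finset ι → ℝ) (X : Finset ι) (hX : 2 ≤ X.card) :
    (∑ i ∈ X, (H X - H {i}) / ((X.card : ℝ) - 1)) ∈
      { s : ℝ | ∃ P : Finset (Finset ι), IsPartition X P ∧ 2 ≤ P.card ∧
        s = ∑ C ∈ P, (H X - H C) / ((P.card : ℝ) - 1) } := by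
  have hinj : Function.Injective (fun i : ι => ({i} : Finset ι)) := Finset.singleton_injective
  refine ⟨_, part_single X, ?_, ?_⟩
  · rwa [Finset.card_image_of_injective _ hinj]
  · rw [Finset.card_image_of_injective _ hinj, Finset.sum_image hinj.injOn]

theorem no_complimentary_subset_asymptotic
    (V : Finset ι) (hV : 2 ≤ V.card) (H : Finset ι → ℝ)
    (αlow : ℝ) (hαlow : αlow = ∑ i ∈ V, (H V - H {i}) / ((V.card : ℝ) - 1))
    (h : ∀ X : Finset ι, X ⊆ V → 2 ≤ X.card → X ≠ V →
      fRes H V αlow X ≠ dilworth H V αlow X) :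
    RACO H V = αlow ∧
      ∀ X : Finset ι, X ⊆ V → 2 ≤ X.card → X ≠ V →
        ¬ (H V - H X + RACO H X ≤ RACO H V) := by
  have hc : (2 : ℝ) ≤ (V.card : ℝ) := by exact_mod_cast hV
  have hlt := single_lt V H αlow h
  have hsum : ∑ i ∈ V, fRes H V αlow {i} = αlow := by
    rw [← Finset.sum_div, eq_div_iff (by linarith)] at hαlow
    simp only [fRes, Finset.sum_add_distrib, Finset.sum_sub_distrib, Finset.sum_const,
      nsmul_eq_mul] at hαlow ⊢
    linarith
  have hR : RACO H V = αlow := by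
    have hm := single_mem H V hV
    rw [← hαlow] at hm
    refine IsGreatest.csSup_eq ⟨hm, ?_⟩
    rintro s ⟨P, hP, hP2, rfl⟩
    have hPc : (2 : ℝ) ≤ (P.card : ℝ) := by exact_mod_cast hP2
    have key : αlow ≤ ∑ C ∈ P, fRes H V αlow C := by
      refine (hsum.symm.trans (part_sum hP _).symm).trans_le ?_
      refine Finset.sum_le_sum fun C hC => ?_
      have hCX := part_sub hP C hC
      have hCne : C ≠ V := by
        rintro rfl
        rw [part_top hP hC] at hP2
        simp at hP2
      rcases Nat.lt_or_ge C.card 2 with h1 | h2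
      · have h3 := Finset.card_pos.2 (hP.1 C hC)
        obtain ⟨i, rfl⟩ := Finset.card_eq_one.1 (show C.card = 1 by omega)
        simp
      · exact (hlt C hCX h2 hCne).le
    rw [← Finset.sum_div, div_le_iff₀ (by linarith)]
    simp only [fRes, Finset.sum_add_distrib, Finset.sum_sub_distrib, Finset.sum_const,
      nsmul_eq_mul] at key ⊢
    linarith
  refine ⟨hR, fun X hXV hX2 hne hle => ?_⟩
  rw [hR] at hle
  have hXc : (2 : ℝ) ≤ (X.card : ℝ) := by exact_mod_cast hX2
  have h1 := hlt X hXV hX2 hne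
  have h2 : _ ≤ RACO H X := le_csSup (part_finite X _ _).bddAbove (single_mem H X hX2)
  rw [← Finset.sum_div, div_le_iff₀ (by linarith)] at h2
  have h3 := mul_le_mul_of_nonneg_right hle (show (0 : ℝ) ≤ (X.card : ℝ) - 1 by linarith)
  simp only [fRes, Finset.sum_add_distrib, Finset.sum_sub_distrib, Finset.sum_const,
      nsmul_eq_mul] at h1 h2
  linarith
end

section
/- Suppose H takes integer values on all subsets of V. Let α_low = ⌈ Σ_{i ∈ V} (H(V) − H({i}))/(|V| − 1) ⌉, let W ⊆ V be nonempty, and let P be a partition of W minimizing Σ_{C ∈ P'} f_{α_low}(C) over all partitions P' of W. Then every block C ∈ P with 2 ≤ |C| and C ≠ V is complimentary for the non-asymptotic model, i.e., satisfies H(V) − H(C) + R_NCO(C) ≤ R_NCO(V). -/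
open Finset

variable {ι : Type*} [DecidableEq ι]

theorem singletons_aux (X : Finset ι) :
    IsPartition X (X.image (fun i => ({i} : Finset ι))) ∧
    (X.image (fun i => ({i} : Finset ι))).card = X.card := by
  refine ⟨⟨?_, ?_, ?_⟩, ?_⟩
  · intro C hC
    obtain ⟨i, _, rfl⟩ := Finset.mem_image.1 hC
    exact Finset.singleton_nonempty i
  · intro C hC D hD hne
    obtain ⟨i, _, rfl⟩ := Finset.mem_image.1 hC
    obtain ⟨j, _, rfl⟩ := Finset.mem_image.1 hD
    rw [Finset.disjoint_singleton]
    rintro rfl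
    exact hne rfl
  · ext x
    simp [Finset.mem_sup]
  · exact Finset.card_image_of_injective _ Finset.singleton_injective

theorem bdd_aux (H : Finset ι → ℝ) (X : Finset ι) :
    BddAbove { s : ℝ | ∃ P : Finset (Finset ι), IsPartition X P ∧ 2 ≤ P.card ∧
    s = ∑ C ∈ P, (H X - H C) / ((P.card : ℝ) - 1) } := by
  apply Set.Finite.bddAbove
  apply Set.Finite.subset ((X.powerset.powerset.image
    (fun P : Finset (Finset ι) => ∑ C ∈ P, (H X - H C) / ((P.card : ℝ) - 1))).finite_toSet)
  rintro s ⟨P, hP, _, rfl⟩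
  rw [Finset.mem_coe, Finset.mem_image]
  refine ⟨P, ?_, rfl⟩
  rw [Finset.mem_powerset]
  intro C hC
  rw [Finset.mem_powerset, ← hP.2.2]
  exact Finset.le_sup (f := id) hC

theorem refine_aux {W C : Finset ι} {P Q : Finset (Finset ι)} (hP : IsPartition W P)
    (hC : C ∈ P) (hQ : IsPartition C Q) :
    IsPartition W (P.erase C ∪ Q) ∧ Disjoint (P.erase C) Q := by
  have hsub : ∀ D ∈ Q, D ⊆ C := fun D hD => by
    rw [← hQ.2.2]; exact Finset.le_sup (f := id) hD
  have key : ∀ A ∈ P.erase C, ∀ D ∈ Q, Disjoint A D := fun A hA D hD =>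
    Finset.disjoint_of_subset_right (hsub D hD)
      (hP.2.1 A (Finset.mem_of_mem_erase hA) C hC (Finset.ne_of_mem_erase hA))
  refine ⟨⟨?_, ?_, ?_⟩, ?_⟩
  · intro A hA
    rcases Finset.mem_union.1 hA with h | h
    · exact hP.1 A (Finset.mem_of_mem_erase h)
    · exact hQ.1 A h
  · intro A hA B hB hne
    rcases Finset.mem_union.1 hA with h | h <;> rcases Finset.mem_union.1 hB with h' | h'
    · exact hP.2.1 A (Finset.mem_of_mem_erase h) B (Finset.mem_of_mem_erase h') hne
    · exact key A h B h'
    · exact (key B h' A h).symm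
    · exact hQ.2.1 A h B h' hne
  · rw [Finset.sup_union, hQ.2.2, ← hP.2.2]
    conv_rhs => rw [← Finset.insert_erase hC, Finset.sup_insert]
    rw [sup_comm]; rfl
  · rw [Finset.disjoint_left]
    intro A hA hA'
    have h := key A hA A hA'
    rw [disjoint_self] at h
    exact (hQ.1 A hA').ne_empty h

theorem minimizer_blocks_complimentary_nonasymptotic
    (V : Finset ι) (hV : 2 ≤ V.card) (H : Finset ι → ℝ)
    (hHint : ∀ X ⊆ V, ∃ z : ℤ, H X = z)
    (αlow : ℝ) (hαlow : αlow = (⌈∑ i ∈ V, (H V - H {i}) / ((V.card : ℝ) - 1)⌉ : ℝ))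
    (W : Finset ι) (hWV : W ⊆ V) (hWne : W.Nonempty)
    (P : Finset (Finset ι)) (hP : IsPartition W P)
    (hmin : ∀ P' : Finset (Finset ι), IsPartition W P' →
      (∑ C ∈ P, fRes H V αlow C) ≤ ∑ C ∈ P', fRes H V αlow C) :
    ∀ C ∈ P, 2 ≤ C.card → C ≠ V → H V - H C + RNCO H C ≤ RNCO H V := by
  intro C hC hC2 _
  have hCW : C ⊆ W := by
    rw [← hP.2.2]; exact Finset.le_sup (f := id) hC
  have h1 : αlow ≤ RNCO H V := by
    rw [hαlow, RNCO]
    have : (∑ i ∈ V, (H V - H {i}) / ((V.card : ℝ) - 1)) ≤ RACO H V := by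
      apply le_csSup (bdd_aux H V)
      refine ⟨_, (singletons_aux V).1, ?_, ?_⟩
      · rw [(singletons_aux V).2]; exact hV
      · rw [(singletons_aux V).2, Finset.sum_image]
        intro a _ b _ hab
        exact Finset.singleton_injective hab
    exact_mod_cast Int.ceil_mono this
  have h2 : RACO H C ≤ αlow - H V + H C := by
    apply csSup_le
    · exact ⟨_, _, (singletons_aux C).1, by rw [(singletons_aux C).2]; exact hC2, rfl⟩
    · rintro s ⟨Q, hQ, hQ2, rfl⟩
      obtain ⟨hR, hd⟩ := refine_aux hP hC hQ
      have hm := hmin _ hR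
      rw [Finset.sum_union hd, ← Finset.add_sum_erase P _ hC] at hm
      have hk : (2 : ℝ) ≤ Q.card := by exact_mod_cast hQ2
      rw [← Finset.sum_div, div_le_iff₀ (by linarith)]
      simp only [fRes, Finset.sum_add_distrib, Finset.sum_sub_distrib, Finset.sum_const,
        nsmul_eq_mul] at hm ⊢
      linarith
  have h3 : RNCO H C ≤ αlow - H V + H C := by
    obtain ⟨a, ha⟩ := hHint V subset_rfl
    obtain ⟨b, hb⟩ := hHint C (hCW.trans hWV)
    rw [hαlow, ha, hb] at h2 ⊢
    rw [RNCO]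
    have h4 : ⌈RACO H C⌉ ≤ ⌈∑ i ∈ V, ((a : ℝ) - H {i}) / ((V.card : ℝ) - 1)⌉ - a + b := by
      apply Int.ceil_le.2
      push_cast
      exact h2
    exact_mod_cast h4
  linarith
end

section
/- Let X ⊆ V with 2 ≤ |X|. For every α ∈ ℝ, f_α(X) = f̂_α(X) holds if and only if α ≥ H(V) − H(X) + R_ACO(X). Consequently, the minimum over all real α of the set { α ∈ ℝ : f_α(X) = f̂_α(X) } exists and equals H(V) − H(X) + R_ACO(X). -/
open Finset

variable {ι : Type*} [DecidableEq ι]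

theorem aux_iff (H : Finset ι → ℝ) (V X : Finset ι) (hX2 : 2 ≤ X.card) (α : ℝ) :
    fRes H V α X = dilworth H V α X ↔ H V - H X + RACO H X ≤ α := by
  have hsub : ∀ P : Finset (Finset ι), IsPartition X P → P ∈ X.powerset.powerset := by
    intro P hP
    rw [Finset.mem_powerset]
    intro C hC
    rw [Finset.mem_powerset]
    have h := Finset.le_sup (f := id) hC
    rw [hP.2.2] at h
    exact h
  have hfinD : { s : ℝ | ∃ P : Finset (Finset ι), IsPartition X P ∧
      s = ∑ C ∈ P, fRes H V α C }.Finite := by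
    apply ((X.powerset.powerset.finite_toSet).image (fun P => ∑ C ∈ P, fRes H V α C)).subset
    rintro s ⟨P, hP, rfl⟩
    exact ⟨P, hsub P hP, rfl⟩
  have hfinR : { s : ℝ | ∃ P : Finset (Finset ι), IsPartition X P ∧ 2 ≤ P.card ∧
      s = ∑ C ∈ P, (H X - H C) / ((P.card : ℝ) - 1) }.Finite := by
    apply ((X.powerset.powerset.finite_toSet).image
      (fun P => ∑ C ∈ P, (H X - H C) / ((P.card : ℝ) - 1))).subset
    rintro s ⟨P, hP, -, rfl⟩
    exact ⟨P, hsub P hP, rfl⟩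
  have hne : X.Nonempty := Finset.card_pos.mp (by omega)
  have htriv : IsPartition X {X} := by
    refine ⟨by simpa using hne, ?_, by simp⟩
    intro C hC D hD h
    simp only [Finset.mem_singleton] at hC hD
    exact absurd (hC.trans hD.symm) h
  have hmemD : fRes H V α X ∈ { s : ℝ | ∃ P : Finset (Finset ι), IsPartition X P ∧
      s = ∑ C ∈ P, fRes H V α C } := ⟨{X}, htriv, by simp⟩
  have hsing : IsPartition X (X.image (fun x => ({x} : Finset ι))) := by
    refine ⟨?_, ?_, ?_⟩
    · intro C hC
      obtain ⟨x, -, rfl⟩ := Finset.mem_image.mp hC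
      simp
    · intro C hC D hD h
      obtain ⟨x, -, rfl⟩ := Finset.mem_image.mp hC
      obtain ⟨y, -, rfl⟩ := Finset.mem_image.mp hD
      rw [Finset.disjoint_singleton]
      rintro rfl
      exact h rfl
    · ext a
      simp [Finset.mem_sup]
  have hcard : (X.image (fun x => ({x} : Finset ι))).card = X.card :=
    Finset.card_image_of_injective _ Finset.singleton_injective
  have hneR : { s : ℝ | ∃ P : Finset (Finset ι), IsPartition X P ∧ 2 ≤ P.card ∧
      s = ∑ C ∈ P, (H X - H C) / ((P.card : ℝ) - 1) }.Nonempty :=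
    ⟨_, _, hsing, by omega, rfl⟩
  have key : ∀ P : Finset (Finset ι), 2 ≤ P.card →
      (fRes H V α X ≤ ∑ C ∈ P, fRes H V α C ↔
        ∑ C ∈ P, (H X - H C) / ((P.card : ℝ) - 1) ≤ α - H V + H X) := by
    intro P hP
    have h2 : (2 : ℝ) ≤ P.card := by exact_mod_cast hP
    rw [← Finset.sum_div, div_le_iff₀ (by linarith)]
    simp only [fRes, Finset.sum_add_distrib, Finset.sum_sub_distrib, Finset.sum_const,
      nsmul_eq_mul]
    constructor <;> intro h <;> nlinarith
  have h1 : fRes H V α X = dilworth H V α X ↔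
      ∀ P, IsPartition X P → fRes H V α X ≤ ∑ C ∈ P, fRes H V α C := by
    constructor
    · intro h P hP
      rw [h]
      exact csInf_le hfinD.bddBelow ⟨P, hP, rfl⟩
    · intro h
      apply le_antisymm
      · apply le_csInf ⟨_, hmemD⟩
        rintro s ⟨P, hP, rfl⟩
        exact h P hP
      · exact csInf_le hfinD.bddBelow hmemD
  have h2 : H V - H X + RACO H X ≤ α ↔ RACO H X ≤ α - H V + H X := by
    constructor <;> intro h <;> linarith
  rw [h1, h2, RACO, csSup_le_iff hfinR.bddAbove hneR]
  constructor
  · rintro h s ⟨P, hP, hc, rfl⟩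
    exact (key P hc).mp (h P hP)
  · intro h P hP
    by_cases hc : 2 ≤ P.card
    · exact (key P hc).mpr (h _ ⟨P, hP, hc, rfl⟩)
    · have hc' : P.card = 0 ∨ P.card = 1 := by omega
      rcases hc' with h0 | h0
      · rw [Finset.card_eq_zero] at h0
        subst h0
        have := hP.2.2
        simp at this
        simp [← this] at hX2
      · obtain ⟨C, rfl⟩ := Finset.card_eq_one.mp h0
        have := hP.2.2
        simp at this
        simp [this]

theorem dilworth_tight_iff_and_least_alpha
    (V : Finset ι) (hV : 2 ≤ V.card) (H : Finset ι → ℝ)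
    (X : Finset ι) (hXV : X ⊆ V) (hX2 : 2 ≤ X.card) :
    (∀ α : ℝ, fRes H V α X = dilworth H V α X ↔ H V - H X + RACO H X ≤ α) ∧
      IsLeast { α : ℝ | fRes H V α X = dilworth H V α X }
        (H V - H X + RACO H X) := by
  have h := aux_iff H V X hX2
  refine ⟨h, (h _).mpr le_rfl, fun α hα => (h α).mp hα⟩
end
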